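/- Let c ≥ 1 and let S ⊆ V with |S| ≤ 2^{h(c−1)}. Then the entire request set V can be partitioned into at most c+1 sets, each of which is S-routable. (In the paper's notation, the S-chromatic number satisfies χ(S) ≤ c+1 whenever |S| ≤ 2^{h(c−1)}.) -/

import Mathlib

open Finset

/-- The vertex/request set of the Friggstad–Gao instance `T^h_FG`: sequences over
`{1,…,2^{h-1}}` of length at most `h-1`, encoded as a pair of a length `< h`
together with a tuple of that length. -/
abbrev FGV (h : ℕ) : Type := Σ k : Fin h, (Fin (k : ℕ) → Fin (2 ^ (h - 1)))

/-- The level of a vertex: its length plus one. -/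
def FGlevel {h : ℕ} (v : FGV h) : ℕ := (v.1 : ℕ) + 1

/-- The prefix order `v ⪯ w` on sequences. -/
def FGprefix {h : ℕ} (v w : FGV h) : Prop :=
  (v.1 : ℕ) ≤ (w.1 : ℕ) ∧
    ∀ i : Fin (v.1 : ℕ), ∀ j : Fin (w.1 : ℕ), (i : ℕ) = (j : ℕ) → w.2 j = v.2 i

instance {h : ℕ} (v w : FGV h) : Decidable (FGprefix v w) := by
  unfold FGprefix; infer_instance

/-- The demand of a level-`ℓ` request: `2^{h(h-ℓ+1)} - 2^{h(h-ℓ)}`. -/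
def FGdemand {h : ℕ} (v : FGV h) : ℝ :=
  2 ^ (h * (h - FGlevel v + 1)) - 2 ^ (h * (h - FGlevel v))

/-- The capacity of the parent edge `e_v` of a level-`ℓ` vertex: `2^{h(h-ℓ+1)}`. -/
def FGcap {h : ℕ} (v : FGV h) : ℝ := 2 ^ (h * (h - FGlevel v + 1))

/-- The profit of a level-`ℓ` request: `2^{-(h-1)(ℓ-1)}`. -/
noncomputable def FGprofit {h : ℕ} (v : FGV h) : ℝ :=
  (2 : ℝ) ^ (-(((h - 1) * (FGlevel v - 1) : ℕ) : ℤ))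

/-- `X` is routable on the edge `e_v`. -/
def RoutableOn {h : ℕ} (X : Finset (FGV h)) (v : FGV h) : Prop :=
  ∑ w ∈ X.filter (fun w => FGprefix v w), FGdemand w ≤ FGcap v

/-- `X` is `S`-routable. -/
def SRoutable {h : ℕ} (X S : Finset (FGV h)) : Prop :=
  ∀ v ∈ S, RoutableOn X v

/-- `X` is routable. -/
def Routable {h : ℕ} (X : Finset (FGV h)) : Prop :=
  ∀ v : FGV h, RoutableOn X v

/-- `K_I(S)` for the Friggstad–Gao instance: the convex hull of indicator
vectors of `S`-routable sets. -/
def FGKI {h : ℕ} (S : Finset (FGV h)) : Set (FGV h → ℝ) :=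
  convexHull ℝ
    {x | ∃ X : Finset (FGV h), SRoutable X S ∧ x = fun w => if w ∈ X then (1 : ℝ) else 0}

/-- `P^t` for the Friggstad–Gao instance. -/
def FGP (h t : ℕ) : Set (FGV h → ℝ) :=
  ⋂ S ∈ {S : Finset (FGV h) | S.card = t}, FGKI S

lemma FGdemand_eq {h : ℕ} (v : FGV h) :
    FGdemand v = (2 : ℝ) ^ (h * (h - v.1)) - 2 ^ (h * (h - (v.1 + 1))) := by
  have := v.1.isLt
  have e : h - ((v.1 : ℕ) + 1) + 1 = h - v.1 := by omega
  simp only [FGdemand, FGlevel, e]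

lemma FGcap_eq {h : ℕ} (v : FGV h) : FGcap v = (2 : ℝ) ^ (h * (h - v.1)) := by
  have := v.1.isLt
  have e : h - ((v.1 : ℕ) + 1) + 1 = h - v.1 := by omega
  simp only [FGcap, FGlevel, e]

lemma FGdemand_le {h : ℕ} (v : FGV h) : FGdemand v ≤ (2 : ℝ) ^ (h * (h - v.1)) := by
  rw [FGdemand_eq]
  linarith [show (0 : ℝ) ≤ 2 ^ (h * (h - (v.1 + 1))) by positivity]

lemma FGdemand_nonneg {h : ℕ} (v : FGV h) : 0 ≤ FGdemand v := by
  rw [FGdemand_eq, sub_nonneg]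
  gcongr
  · norm_num
  · omega

lemma FGprefix.eq_of_fst_eq {h : ℕ} {v w : FGV h} (hp : FGprefix v w)
    (he : (w.1 : ℕ) = v.1) : w = v := by
  obtain ⟨k, f⟩ := v
  obtain ⟨m, g⟩ := w
  obtain rfl : m = k := Fin.ext he
  congr 1
  funext i
  exact hp.2 i i rfl

lemma card_extensions_le {h : ℕ} (v : FGV h) (m : Fin h) (hm : (v.1 : ℕ) ≤ m) :
    #{f : Fin (m : ℕ) → Fin (2 ^ (h - 1)) | FGprefix v ⟨m, f⟩} ≤
      (2 ^ (h - 1)) ^ ((m : ℕ) - v.1) := by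
  have hcard : #(univ : Finset (Fin ((m : ℕ) - v.1) → Fin (2 ^ (h - 1)))) =
      (2 ^ (h - 1)) ^ ((m : ℕ) - v.1) := by simp
  rw [← hcard]
  refine card_le_card_of_injOn
    (fun f i => f ⟨v.1 + i, by have := i.isLt; omega⟩) (fun _ _ => mem_coe.2 (mem_univ _)) ?_
  intro f hf g hg hfg
  simp only [coe_filter, mem_univ, true_and, Set.mem_ofPred_eq] at hf hg
  funext j
  by_cases hj : (j : ℕ) < v.1
  · exact (hf.2 ⟨j, hj⟩ j rfl).trans (hg.2 ⟨j, hj⟩ j rfl).symm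
  · have := congrFun hfg ⟨j - v.1, by have := j.isLt; omega⟩
    have e : (⟨v.1 + (j - v.1), by have := j.isLt; omega⟩ : Fin (m : ℕ)) = j :=
      Fin.ext (by simp only; omega)
    simpa only [e] using this

lemma sum_half_pow_shift (k n : ℕ) :
    ∑ m ∈ range n, (if k < m then (1 / 2 : ℝ) ^ (m - k) else 0) =
      1 - (1 / 2) ^ (n - 1 - k) := by
  induction n with
  | zero => simp
  | succ n ih =>
    rw [sum_range_succ, ih]
    split_ifs with hk
    · have e : n - k = (n - 1 - k) + 1 := by omega
      rw [Nat.add_sub_cancel, e, pow_succ]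
      ring
    · have e₁ : n - 1 - k = 0 := by omega
      have e₂ : n + 1 - 1 - k = 0 := by omega
      rw [e₁, e₂, add_zero]

/-- The total demand strictly below `v` fits on the edge `e_v`. -/
lemma sum_demand_strict_descendants_le {h : ℕ} (v : FGV h) :
    ∑ w with FGprefix v w ∧ (v.1 : ℕ) < w.1, FGdemand w ≤ FGcap v := by
  rw [sum_filter, Fintype.sum_sigma, FGcap_eq]
  have hlevel : ∀ m : Fin h,
      (∑ f : Fin (m : ℕ) → Fin (2 ^ (h - 1)),
        if FGprefix v ⟨m, f⟩ ∧ (v.1 : ℕ) < m then FGdemand ⟨m, f⟩ else 0) ≤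
      (2 : ℝ) ^ (h * (h - v.1)) *
        (if (v.1 : ℕ) < m then (1 / 2 : ℝ) ^ ((m : ℕ) - v.1) else 0) := by
    intro m
    by_cases hm : (v.1 : ℕ) < m
    · simp only [hm, and_true, if_true]
      rw [← sum_filter]
      calc _ ≤ #{f : Fin (m : ℕ) → Fin (2 ^ (h - 1)) | FGprefix v ⟨m, f⟩} •
              (2 : ℝ) ^ (h * (h - m)) :=
            sum_le_card_nsmul _ _ _ fun f _ => FGdemand_le ⟨m, f⟩
        _ ≤ ((2 ^ (h - 1)) ^ ((m : ℕ) - v.1) : ℕ) * (2 : ℝ) ^ (h * (h - m)) := by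
            rw [nsmul_eq_mul]
            gcongr
            exact card_extensions_le v m hm.le
        _ = _ := by
            have hmh := m.isLt
            obtain ⟨a, ha⟩ := Nat.exists_eq_add_of_lt hm
            obtain ⟨b, hb⟩ := Nat.exists_eq_add_of_lt hmh
            have e₁ : (m : ℕ) - v.1 = a + 1 := by omega
            have e₂ : h - m = b + 1 := by omega
            have e₃ : h - v.1 = (a + 1) + (b + 1) := by omega
            obtain ⟨p, rfl⟩ : ∃ p, h = p + 1 := ⟨h - 1, by omega⟩
            rw [e₁, e₂, e₃, one_div, inv_pow, ← div_eq_mul_inv,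
              eq_div_iff (by positivity)]
            push_cast
            rw [← pow_mul, ← pow_add, ← pow_add]
            congr 1
            ring
    · simp [hm]
  calc _ ≤ ∑ m : Fin h, (2 : ℝ) ^ (h * (h - v.1)) *
          (if (v.1 : ℕ) < m then (1 / 2 : ℝ) ^ ((m : ℕ) - v.1) else 0) :=
        sum_le_sum fun m _ => hlevel m
    _ = (2 : ℝ) ^ (h * (h - v.1)) * (1 - (1 / 2) ^ (h - 1 - v.1)) := by
        rw [← mul_sum, ← sum_half_pow_shift,
          Fin.sum_univ_eq_sum_range
            (fun m => if (v.1 : ℕ) < m then (1 / 2 : ℝ) ^ (m - v.1) else 0)]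
    _ ≤ _ := by
        apply mul_le_of_le_one_right (by positivity)
        linarith [show (0 : ℝ) ≤ (1 / 2) ^ (h - 1 - (v.1 : ℕ)) by positivity]

lemma routableOn_of_notMem {h : ℕ} {X : Finset (FGV h)} {v : FGV h} (hv : v ∉ X) :
    RoutableOn X v := by
  refine le_trans (sum_le_sum_of_subset_of_nonneg ?_ fun w _ _ => FGdemand_nonneg w)
    (sum_demand_strict_descendants_le v)
  intro w hw
  obtain ⟨hwX, hp⟩ := mem_filter.1 hw
  refine mem_filter.2 ⟨mem_univ _, hp, lt_of_le_of_ne hp.1 fun he => hv ?_⟩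
  rwa [← hp.eq_of_fst_eq he.symm]

/-- A small set is routable on `e_v` if its members below `v` are `v` itself
or lie at least `c` levels deeper. -/
lemma routableOn_of_level_gap {h c : ℕ} (hc : 1 ≤ c) {X : Finset (FGV h)} {v : FGV h}
    (hX : #X ≤ 2 ^ (h * (c - 1)))
    (hgap : ∀ w ∈ X, FGprefix v w → w ≠ v → (v.1 : ℕ) + c ≤ w.1) :
    RoutableOn X v := by
  set Y := (X.filter fun w => FGprefix v w).erase v with hY
  have hdemand : ∀ w ∈ Y,
      FGdemand w ≤ (2 : ℝ) ^ (h * (h - (v.1 + 1))) / 2 ^ (h * (c - 1)) := by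
    intro w hw
    obtain ⟨hne, hw⟩ := mem_erase.1 hw
    obtain ⟨hwX, hp⟩ := mem_filter.1 hw
    have hg := hgap w hwX hp hne
    have hlt := w.1.isLt
    refine (FGdemand_le w).trans ?_
    rw [le_div_iff₀ (by positivity), ← pow_add, ← mul_add]
    gcongr
    · norm_num
    · omega
  have hsum : ∑ w ∈ Y, FGdemand w ≤ (2 : ℝ) ^ (h * (h - (v.1 + 1))) := by
    have hcard : (#Y : ℝ) ≤ 2 ^ (h * (c - 1)) := by
      exact_mod_cast (card_le_card ((erase_subset _ _).trans (filter_subset _ _))).trans hX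
    calc _ ≤ #Y • ((2 : ℝ) ^ (h * (h - (v.1 + 1))) / 2 ^ (h * (c - 1))) :=
          sum_le_card_nsmul _ _ _ hdemand
      _ ≤ (2 : ℝ) ^ (h * (c - 1)) *
            ((2 : ℝ) ^ (h * (h - (v.1 + 1))) / 2 ^ (h * (c - 1))) := by
          rw [nsmul_eq_mul]
          gcongr
      _ = _ := mul_div_cancel₀ _ (by positivity)
  calc _ ≤ ∑ w ∈ insert v Y, FGdemand w :=
        sum_le_sum_of_subset_of_nonneg (subset_insert_iff.2 subset_rfl)
          fun w _ _ => FGdemand_nonneg w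
    _ = FGdemand v + ∑ w ∈ Y, FGdemand w := sum_insert (by simp [hY])
    _ ≤ FGcap v := by
        rw [FGdemand_eq, FGcap_eq]
        linarith

theorem chromatic_bound (h : ℕ) (hh : 2 ≤ h) (c : ℕ) (hc : 1 ≤ c)
    (S : Finset (FGV h)) (hS : S.card ≤ 2 ^ (h * (c - 1))) :
    ∃ 𝒳 : Finset (Finset (FGV h)), 𝒳.card ≤ c + 1 ∧
      (∀ w : FGV h, ∃ X ∈ 𝒳, w ∈ X) ∧
      (∀ X ∈ 𝒳, ∀ Y ∈ 𝒳, X ≠ Y → Disjoint X Y) ∧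
      (∀ X ∈ 𝒳, SRoutable X S) := by
  classical
  let color : FGV h → ℕ := fun w => if w ∈ S then (w.1 : ℕ) % c else c
  have hmod : ∀ n : ℕ, n % c < c := fun n => Nat.mod_lt _ hc
  refine ⟨(range (c + 1)).image fun i => univ.filter fun w => color w = i, ?_, ?_, ?_, ?_⟩
  · exact card_image_le.trans (card_range _).le
  · intro w
    refine ⟨_, mem_image_of_mem _ (mem_range.2 (?_ : color w < c + 1)), by simp⟩
    have := hmod w.1
    simp only [color]
    split_ifs <;> omega
  · simp only [mem_image]
    rintro _ ⟨i, -, rfl⟩ _ ⟨j, -, rfl⟩ hne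
    refine disjoint_filter.2 fun w _ hi hj => hne ?_
    rw [← hi, ← hj]
  · simp only [mem_image]
    rintro _ ⟨i, -, rfl⟩ v hv
    by_cases hvi : color v = i
    · have hvc : (v.1 : ℕ) % c = i := by simpa [color, hv] using hvi
      have hmem : ∀ w, color w = i → w ∈ S ∧ (w.1 : ℕ) % c = i := by
        intro w hw
        have := hmod v.1
        simp only [color] at hw
        split_ifs at hw with hwS
        · exact ⟨hwS, hw⟩
        · omega
      refine routableOn_of_level_gap hc
        ((card_le_card fun w hw => (hmem w (mem_filter.1 hw).2).1).trans hS) ?_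
      intro w hw hp hne
      have hwc := (hmem w (mem_filter.1 hw).2).2
      have hlt : (v.1 : ℕ) < w.1 :=
        lt_of_le_of_ne hp.1 fun he => hne (hp.eq_of_fst_eq he.symm)
      have hdvd : c ∣ (w.1 : ℕ) - v.1 :=
        (Nat.modEq_iff_dvd' hp.1).1 (hvc.trans hwc.symm)
      have := Nat.le_of_dvd (by omega) hdvd
      omega
    · exact routableOn_of_notMem (by simpa using hvi)
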